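/- arXiv:1707.05232 — 4 statements merged into one kernel-verified Lean document; each statement's English description precedes it below -/
import Mathlib

section
/- Consider the model y = Xβ* + ε with ε ~ N(0, σ²I_n), where β* ∈ ℝᵖ has support S of cardinality s and the columns of X satisfy ‖X_j‖₂² = n. If X satisfies the restricted eigenvalue condition RE(3, s) and λ = 2σ√(2 log(p/δ)/n) for δ ∈ (0,1), then with probability at least 1 − δ any Lasso solution β̂ with tuning parameter λ satisfies (1/n)‖X(β* − β̂)‖₂² ≤ 9λ²s/(4κ²(3, s)). -/
open MeasureTheory ProbabilityTheory Finset

noncomputable section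

/-- Product Gaussian measure `N(0, σ² I_n)` on `ℝⁿ`. -/
def gaussianVec (n : ℕ) (σ : ℝ) : Measure (Fin n → ℝ) :=
  Measure.pi fun _ => gaussianReal 0 (σ ^ 2).toNNReal

/-- Squared Euclidean norm. -/
def l2sq {m : ℕ} (v : Fin m → ℝ) : ℝ := ∑ i, (v i) ^ 2

/-- Euclidean norm. -/
def l2 {m : ℕ} (v : Fin m → ℝ) : ℝ := Real.sqrt (l2sq v)

/-- ℓ₁ norm. -/
def l1 {m : ℕ} (v : Fin m → ℝ) : ℝ := ∑ i, |v i|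

/-- Lasso objective `(1/2n)‖y − Xβ‖₂² + λ‖β‖₁`. -/
def lassoObj {n p : ℕ} (X : Matrix (Fin n) (Fin p) ℝ) (y : Fin n → ℝ) (lam : ℝ)
    (β : Fin p → ℝ) : ℝ :=
  l2sq (y - X.mulVec β) / (2 * (n : ℝ)) + lam * l1 β

/-- `b` is a Lasso solution with tuning parameter `lam`. -/
def IsLassoSol {n p : ℕ} (X : Matrix (Fin n) (Fin p) ℝ) (y : Fin n → ℝ) (lam : ℝ)
    (b : Fin p → ℝ) : Prop :=
  ∀ β : Fin p → ℝ, lassoObj X y lam b ≤ lassoObj X y lam β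

/-- Restricted eigenvalue condition RE(c₀, s) with constant `κ`:
for every `J` with `|J| ≤ s` and every `Δ` with `‖Δ_{Jᶜ}‖₁ ≤ c₀‖Δ_J‖₁`,
one has `‖XΔ‖₂² ≥ κ² n ‖Δ_J‖₂²`. -/
def RE {n p : ℕ} (X : Matrix (Fin n) (Fin p) ℝ) (c0 : ℝ) (s : ℕ) (κ : ℝ) : Prop :=
  0 < κ ∧ ∀ J : Finset (Fin p), J.card ≤ s → ∀ Δ : Fin p → ℝ,
    (∑ j ∈ Jᶜ, |Δ j|) ≤ c0 * ∑ j ∈ J, |Δ j| →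
    κ ^ 2 * ((n : ℝ) * ∑ j ∈ J, (Δ j) ^ 2) ≤ l2sq (X.mulVec Δ)

/-- The Lasso subgradient `ρ̂ = Xᵀ(y − Xβ̂)/(λ n)`. -/
def lassoSubgrad {n p : ℕ} (X : Matrix (Fin n) (Fin p) ℝ) (y : Fin n → ℝ) (lam : ℝ)
    (b : Fin p → ℝ) : Fin p → ℝ :=
  fun j => (X.transpose.mulVec (y - X.mulVec b)) j / (lam * (n : ℝ))

/-- Boosted Lasso objective `(1/2n)‖y − Xβ‖₂² + λ₂‖β − β̂‖₁`. -/
def boostedObj {n p : ℕ} (X : Matrix (Fin n) (Fin p) ℝ) (y : Fin n → ℝ) (lam2 : ℝ)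
    (bhat β : Fin p → ℝ) : ℝ :=
  l2sq (y - X.mulVec β) / (2 * (n : ℝ)) + lam2 * l1 (β - bhat)

/-- `b` is a Boosted Lasso solution built upon the first-step estimator `bhat`. -/
def IsBoostedSol {n p : ℕ} (X : Matrix (Fin n) (Fin p) ℝ) (y : Fin n → ℝ) (lam2 : ℝ)
    (bhat b : Fin p → ℝ) : Prop :=
  ∀ β : Fin p → ℝ, boostedObj X y lam2 bhat b ≤ boostedObj X y lam2 bhat β

/-- Bregman Lasso objective
`(1/2n)‖y − Xβ‖₂² + λ₂(‖β‖₁ − ⟨ρ̂^{λ₁}, β⟩)` where `ρ̂^{λ₁}` is the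
Lasso subgradient associated with `bhat`. -/
def bregmanObj {n p : ℕ} (X : Matrix (Fin n) (Fin p) ℝ) (y : Fin n → ℝ) (lam1 lam2 : ℝ)
    (bhat β : Fin p → ℝ) : ℝ :=
  l2sq (y - X.mulVec β) / (2 * (n : ℝ)) +
    lam2 * (l1 β - ∑ j, lassoSubgrad X y lam1 bhat j * β j)

/-- `b` is a Bregman Lasso solution with parameters `(lam1, lam2)`. -/
def IsBregmanSol {n p : ℕ} (X : Matrix (Fin n) (Fin p) ℝ) (y : Fin n → ℝ) (lam1 lam2 : ℝ)
    (bhat b : Fin p → ℝ) : Prop :=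
  ∀ β : Fin p → ℝ, bregmanObj X y lam1 lam2 bhat b ≤ bregmanObj X y lam1 lam2 bhat β

/-- `bbar` is a sign-consistent refitting of the Lasso solution `bhat`:
it does not increase the residual norm and `(1/n)Xᵀ(y − Xβ̂) ∈ λ·sign(β̄)`
componentwise. -/
def SignConsistentRefit {n p : ℕ} (X : Matrix (Fin n) (Fin p) ℝ) (y : Fin n → ℝ) (lam : ℝ)
    (bhat bbar : Fin p → ℝ) : Prop :=
  l2 (y - X.mulVec bbar) ≤ l2 (y - X.mulVec bhat) ∧
  ∀ j, (0 < bbar j → X.transpose.mulVec (y - X.mulVec bhat) j / (n : ℝ) = lam) ∧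
       (bbar j < 0 → X.transpose.mulVec (y - X.mulVec bhat) j / (n : ℝ) = -lam) ∧
       (bbar j = 0 → |X.transpose.mulVec (y - X.mulVec bhat) j / (n : ℝ)| ≤ lam)

/-- `bbar` is a Sign-Least-Squares Lasso refitting of the Lasso solution `bhat`:
it vanishes outside the equicorrelation set `E = {j : |ρ̂_j| = 1}` and minimizes
the residual sum of squares among all vectors supported on `E` whose coordinates
have signs compatible with `ρ̂_E`. -/
def IsSLSSol {n p : ℕ} (X : Matrix (Fin n) (Fin p) ℝ) (y : Fin n → ℝ) (lam : ℝ)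
    (bhat bbar : Fin p → ℝ) : Prop :=
  (∀ j, |lassoSubgrad X y lam bhat j| ≠ 1 → bbar j = 0) ∧
  (∀ j, 0 ≤ lassoSubgrad X y lam bhat j * bbar j) ∧
  ∀ β : Fin p → ℝ,
    ((∀ j, |lassoSubgrad X y lam bhat j| ≠ 1 → β j = 0) ∧
     (∀ j, 0 ≤ lassoSubgrad X y lam bhat j * β j)) →
    l2sq (y - X.mulVec bbar) ≤ l2sq (y - X.mulVec β)

/-- Componentwise soft-thresholding operator `softThresh(y, λ)_j = sign(y_j)(|y_j| − λ)₊`. -/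
def softThresh {p : ℕ} (y : Fin p → ℝ) (lam : ℝ) : Fin p → ℝ :=
  fun j => Real.sign (y j) * max (|y j| - lam) 0

/-- Componentwise firm-thresholding (MCP) operator. -/
def MCP {p : ℕ} (y : Fin p → ℝ) (μ γ : ℝ) : Fin p → ℝ :=
  fun j => if |y j| ≤ μ * γ then γ / (γ - 1) * (Real.sign (y j) * max (|y j| - μ) 0) else y j

/-- Bregman objective in the denoising (orthogonal, `X = I_p`) case:
`(1/2)‖y − β‖₂² + λ(‖β‖₁ − ⟨ρ, β⟩)`. -/
def denoiseBregObj {p : ℕ} (y ρ : Fin p → ℝ) (lam : ℝ) (β : Fin p → ℝ) : ℝ :=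
  (1 / 2) * l2sq (y - β) + lam * (l1 β - ∑ j, ρ j * β j)

end

section GaussianTails

open scoped NNReal

/-- The part of a centered Gaussian beyond a level of size `|a|` is dominated by the Gaussian
recentered there, up to the factor `exp (-a² / (2v))`. -/
lemma gaussianReal_zero_le_exp_mul_gaussianReal (v : ℝ≥0) (hv : v ≠ 0) (a : ℝ) (A : Set ℝ)
    (hA : MeasurableSet A) (h : ∀ x ∈ A, a ^ 2 ≤ a * x) :
    gaussianReal 0 v A ≤ ENNReal.ofReal (Real.exp (-a ^ 2 / (2 * v))) * gaussianReal a v A := by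
  rw [gaussianReal_apply _ hv, gaussianReal_apply _ hv,
    ← lintegral_const_mul _ (measurable_gaussianPDF a v)]
  refine setLIntegral_mono' hA fun x hx => ?_
  rw [gaussianPDF, gaussianPDF, ← ENNReal.ofReal_mul (Real.exp_nonneg _)]
  apply ENNReal.ofReal_le_ofReal
  rw [gaussianPDFReal, gaussianPDFReal, mul_left_comm, ← Real.exp_add, ← add_div]
  have hv' : (0 : ℝ) < v := by positivity
  gcongr
  nlinarith [h x hx]

/-- Two-sided tail bound for a centered Gaussian, with constant one. -/
lemma gaussianReal_abs_gt_le (v : ℝ≥0) (hv : v ≠ 0) (t : ℝ) (ht : 0 ≤ t) :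
    gaussianReal 0 v {x | t < |x|} ≤ ENNReal.ofReal (Real.exp (-t ^ 2 / (2 * v))) := by
  have hset : {x : ℝ | t < |x|} = Set.Ioi t ∪ Set.Iio (-t) := by
    ext x
    simp only [Set.mem_ofPred_eq, Set.mem_union, Set.mem_Ioi, Set.mem_Iio, lt_abs, lt_neg]
  have h1 := gaussianReal_zero_le_exp_mul_gaussianReal v hv t (Set.Ioi t) measurableSet_Ioi
    fun x hx => by nlinarith [Set.mem_Ioi.1 hx]
  have h2 := gaussianReal_zero_le_exp_mul_gaussianReal v hv (-t) (Set.Iio (-t)) measurableSet_Iio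
    fun x hx => by nlinarith [Set.mem_Iio.1 hx]
  have e1 : gaussianReal t v (Set.Ioi t) = gaussianReal 0 v (Set.Ioi 0) := by
    have := gaussianReal_map_add_const (μ := 0) (v := v) t
    rw [zero_add] at this
    rw [← this, Measure.map_apply (measurable_add_const t) measurableSet_Ioi]
    simp
  have e2 : gaussianReal (-t) v (Set.Iio (-t)) = gaussianReal 0 v (Set.Iio 0) := by
    have := gaussianReal_map_add_const (μ := 0) (v := v) (-t)
    rw [zero_add] at this
    rw [← this, Measure.map_apply (measurable_add_const _) measurableSet_Iio]
    simp
  rw [e1] at h1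
  rw [e2, neg_sq] at h2
  calc gaussianReal 0 v {x | t < |x|}
      ≤ gaussianReal 0 v (Set.Ioi t) + gaussianReal 0 v (Set.Iio (-t)) := by
        rw [hset]; exact measure_union_le _ _
    _ ≤ ENNReal.ofReal (Real.exp (-t ^ 2 / (2 * v))) *
          (gaussianReal 0 v (Set.Ioi 0) + gaussianReal 0 v (Set.Iio 0)) := by
        rw [mul_add]; exact add_le_add h1 h2
    _ = ENNReal.ofReal (Real.exp (-t ^ 2 / (2 * v))) *
          gaussianReal 0 v (Set.Ioi 0 ∪ Set.Iio 0) := by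
        rw [measure_union (Set.Ioi_disjoint_Iio_of_le le_rfl) measurableSet_Iio]
    _ ≤ _ := mul_le_of_le_one_right' prob_le_one

/-- A linear functional of an i.i.d. centered Gaussian vector is a centered Gaussian. -/
lemma map_pi_gaussianReal_sum_mul {ι : Type*} [Fintype ι] (v : ℝ≥0) (a : ι → ℝ) :
    (Measure.pi fun _ : ι => gaussianReal 0 v).map (fun ε => ∑ i, a i * ε i) =
      gaussianReal 0 ((∑ i, (a i) ^ 2).toNNReal * v) := by
  have hind : iIndepFun (fun i (ε : ι → ℝ) => a i * ε i)
      (Measure.pi fun _ : ι => gaussianReal 0 v) :=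
    iIndepFun_pi (X := fun i (x : ℝ) => a i * x) fun i => by fun_prop
  refine Measure.ext_of_charFun ?_
  rw [hind.charFun_map_fun_sum_eq_prod fun i => ((measurable_pi_apply i).const_mul _).aemeasurable]
  ext t
  have hlaw (i : ι) : (Measure.pi fun _ : ι => gaussianReal 0 v).map (fun ε => a i * ε i) =
      gaussianReal 0 (.mk ((a i) ^ 2) (sq_nonneg _) * v) := by
    have h := gaussianReal_map_const_mul (μ := 0) (v := v) (a i)
    rw [mul_zero] at h
    have he := (measurePreserving_eval (fun _ : ι => gaussianReal 0 v) i).map_eq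
    refine Eq.trans ?_ ((congrArg (Measure.map (a i * ·)) he).trans h)
    rw [Measure.map_map (by fun_prop) (by fun_prop)]
    rfl
  simp_rw [Finset.prod_apply, hlaw, charFun_gaussianReal, ← Complex.exp_sum]
  congr 1
  have hnn : 0 ≤ ∑ i, (a i) ^ 2 := Finset.sum_nonneg fun i _ => sq_nonneg _
  simp [Real.coe_toNNReal _ hnn, Finset.sum_mul, Finset.sum_div]

end GaussianTails

section LassoBounds

variable {n p : ℕ}

lemma l2sq_sub_smul {m : ℕ} (r d : Fin m → ℝ) (t : ℝ) :
    l2sq (r - t • d) = l2sq r - 2 * t * (r ⬝ᵥ d) + t ^ 2 * l2sq d := by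
  simp only [l2sq, dotProduct, Finset.mul_sum, ← Finset.sum_sub_distrib, ← Finset.sum_add_distrib]
  refine Finset.sum_congr rfl fun i _ => ?_
  simp only [Pi.sub_apply, Pi.smul_apply, smul_eq_mul]
  ring

lemma l1_add_smul_sub_le {m : ℕ} (b β : Fin m → ℝ) (t : ℝ) (h0 : 0 ≤ t) (h1 : t ≤ 1) :
    l1 (b + t • (β - b)) ≤ l1 b + t * (l1 β - l1 b) := by
  simp only [l1, Finset.mul_sum, ← Finset.sum_sub_distrib, ← Finset.sum_add_distrib]
  refine Finset.sum_le_sum fun i _ => ?_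
  simp only [Pi.add_apply, Pi.sub_apply, Pi.smul_apply, smul_eq_mul]
  calc |b i + t * (β i - b i)| = |(1 - t) * b i + t * β i| := by congr 1; ring
    _ ≤ |(1 - t) * b i| + |t * β i| := abs_add_le _ _
    _ = |b i| + t * (|β i| - |b i|) := by
      rw [abs_mul, abs_mul, abs_of_nonneg h0, abs_of_nonneg (sub_nonneg.2 h1)]; ring

/-- First-order optimality of a Lasso solution, in variational form. -/
lemma IsLassoSol.dotProduct_le {X : Matrix (Fin n) (Fin p) ℝ} {y : Fin n → ℝ} {lam : ℝ}
    {b : Fin p → ℝ} (hb : IsLassoSol X y lam b) (hn : 0 < n) (hlam : 0 ≤ lam) (β : Fin p → ℝ) :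
    (y - X.mulVec b) ⬝ᵥ X.mulVec (β - b) ≤ n * (lam * (l1 β - l1 b)) := by
  have hn' : (0 : ℝ) < n := by exact_mod_cast hn
  set r := y - X.mulVec b with hr
  set d := X.mulVec (β - b) with hd
  have key : ∀ t : ℝ, 0 < t → t ≤ 1 →
      r ⬝ᵥ d ≤ n * (lam * (l1 β - l1 b)) + t * (l2sq d / 2) := by
    intro t h0 h1
    have h := hb (b + t • (β - b))
    have hres : y - X.mulVec (b + t • (β - b)) = r - t • d := by
      rw [Matrix.mulVec_add, Matrix.mulVec_smul, ← sub_sub]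
    unfold lassoObj at h
    rw [hres, ← hr, l2sq_sub_smul] at h
    have hl := mul_le_mul_of_nonneg_left (l1_add_smul_sub_le b β t h0.le h1) hlam
    have h2 : 0 ≤ (-2 * t * (r ⬝ᵥ d) + t ^ 2 * l2sq d) / (2 * n)
        + lam * (t * (l1 β - l1 b)) := by
      have : (l2sq r - 2 * t * (r ⬝ᵥ d) + t ^ 2 * l2sq d) / (2 * n)
        = l2sq r / (2 * n) + (-2 * t * (r ⬝ᵥ d) + t ^ 2 * l2sq d) / (2 * n) := by ring
      linarith
    have h3 : (-2 * t * (r ⬝ᵥ d) + t ^ 2 * l2sq d) / (2 * n) + lam * (t * (l1 β - l1 b))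
        = t / n * (n * (lam * (l1 β - l1 b)) + t * (l2sq d / 2) - r ⬝ᵥ d) := by
      field_simp; ring
    rw [h3] at h2
    have := nonneg_of_mul_nonneg_right h2 (by positivity)
    linarith
  by_contra! hlt
  set g := r ⬝ᵥ d - n * (lam * (l1 β - l1 b)) with hg
  have hgpos : 0 < g := by rw [hg]; linarith
  have hq : 0 ≤ l2sq d := Finset.sum_nonneg fun i _ => sq_nonneg _
  have hden : 0 < g + l2sq d := by linarith
  have h := key (g / (g + l2sq d)) (by positivity) (by rw [div_le_one hden]; linarith)
  have h4 : g / (g + l2sq d) * (l2sq d / 2) ≤ g / 2 := by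
    rw [div_mul_eq_mul_div, div_le_iff₀ hden]
    nlinarith [mul_pos hgpos hgpos, mul_nonneg hgpos.le hq]
  linarith

/-- Fast-rate prediction bound for the Lasso on the event that the noise is dominated by half
the tuning parameter. -/
lemma IsLassoSol.prediction_bound {X : Matrix (Fin n) (Fin p) ℝ} {ε : Fin n → ℝ} {lam κ : ℝ}
    {bstar b : Fin p → ℝ} (hn : 0 < n) (hlam : 0 < lam) {s : ℕ}
    (hs : (Finset.univ.filter fun j => bstar j ≠ 0).card = s) (hRE : RE X 3 s κ)
    (hε : ∀ j, |∑ i, X i j * ε i| ≤ n * lam / 2)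
    (hb : IsLassoSol X (X.mulVec bstar + ε) lam b) :
    l2sq (X.mulVec (bstar - b)) / (n : ℝ) ≤ 9 * lam ^ 2 * (s : ℝ) / (4 * κ ^ 2) := by
  have hn' : (0 : ℝ) < n := by exact_mod_cast hn
  obtain ⟨hκ, hRE⟩ := hRE
  set S := Finset.univ.filter fun j => bstar j ≠ 0 with hS
  set Δ := bstar - b with hΔ
  set A := l2sq (X.mulVec Δ) with hA
  have hA0 : 0 ≤ A := Finset.sum_nonneg fun i _ => sq_nonneg _
  have hopt := hb.dotProduct_le hn hlam.le bstar
  have hres : X.mulVec bstar + ε - X.mulVec b = X.mulVec Δ + ε := by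
    rw [hΔ, Matrix.mulVec_sub]; abel
  have hAA : X.mulVec Δ ⬝ᵥ X.mulVec Δ = A := by simp [hA, l2sq, dotProduct, sq]
  rw [hres, ← hΔ, add_dotProduct, hAA] at hopt
  have hnoise : -(ε ⬝ᵥ X.mulVec Δ) ≤ n * lam / 2 * l1 Δ := by
    have : ε ⬝ᵥ X.mulVec Δ = ∑ j, (∑ i, X i j * ε i) * Δ j := by
      rw [Matrix.dotProduct_mulVec]
      simp [dotProduct, Matrix.vecMul, mul_comm]
    rw [this, l1, Finset.mul_sum, ← Finset.sum_neg_distrib]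
    refine Finset.sum_le_sum fun j _ => ?_
    calc -((∑ i, X i j * ε i) * Δ j) ≤ |(∑ i, X i j * ε i) * Δ j| := neg_le_abs _
      _ = |∑ i, X i j * ε i| * |Δ j| := abs_mul _ _
      _ ≤ _ := mul_le_mul_of_nonneg_right (hε j) (abs_nonneg _)
  set u := ∑ j ∈ S, |Δ j| with hu
  set w := ∑ j ∈ Sᶜ, |Δ j| with hw
  have hl1Δ : l1 Δ = u + w := (Finset.sum_add_sum_compl S _).symm
  have hcone : l1 bstar - l1 b ≤ u - w := by
    rw [l1, l1, ← Finset.sum_sub_distrib, ← Finset.sum_add_sum_compl S, sub_eq_add_neg u w, hw,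
      ← Finset.sum_neg_distrib]
    refine add_le_add (Finset.sum_le_sum fun j _ => abs_sub_abs_le_abs_sub _ _)
      (Finset.sum_le_sum fun j hj => ?_)
    have h0 : bstar j = 0 := by simpa [hS] using hj
    simp [hΔ, h0]
  have hw0 : 0 ≤ w := Finset.sum_nonneg fun j _ => abs_nonneg _
  have hu0 : 0 ≤ u := Finset.sum_nonneg fun j _ => abs_nonneg _
  have hnl : 0 < n * lam := by positivity
  have hmain : A ≤ n * lam / 2 * (3 * u - w) := by
    have := mul_le_mul_of_nonneg_left hcone hnl.le
    rw [hl1Δ] at hnoise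
    nlinarith
  have hc : w ≤ 3 * u := by
    have := nonneg_of_mul_nonneg_right (hA0.trans hmain) (by positivity)
    linarith
  have hre := hRE S hs.le Δ hc
  rw [← hA] at hre
  have hcs : u ^ 2 ≤ s * ∑ j ∈ S, (Δ j) ^ 2 := by
    have := sq_sum_le_card_mul_sum_sq (s := S) (f := fun j => |Δ j|)
    simpa [hs] using this
  have hku : κ ^ 2 * (n * u ^ 2) ≤ s * A := by
    calc κ ^ 2 * (n * u ^ 2) ≤ κ ^ 2 * (n * (s * ∑ j ∈ S, (Δ j) ^ 2)) := by gcongr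
      _ = s * (κ ^ 2 * (n * ∑ j ∈ S, (Δ j) ^ 2)) := by ring
      _ ≤ s * A := by gcongr
  have hAu : A ≤ 3 / 2 * (n * lam) * u := by nlinarith
  have hAsq : A ^ 2 ≤ (3 / 2 * (n * lam) * u) ^ 2 := by gcongr
  have hκ2 : 0 < κ ^ 2 := by positivity
  have hprod : A * (A * κ ^ 2) ≤ A * (9 / 4 * n * lam ^ 2 * s) := by
    calc A * (A * κ ^ 2) = A ^ 2 * κ ^ 2 := by ring
      _ ≤ (3 / 2 * (n * lam) * u) ^ 2 * κ ^ 2 := by gcongr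
      _ = 9 / 4 * n * lam ^ 2 * (κ ^ 2 * (n * u ^ 2)) := by ring
      _ ≤ 9 / 4 * n * lam ^ 2 * (s * A) := by gcongr
      _ = _ := by ring
  rw [div_le_div_iff₀ hn' (by positivity)]
  rcases hA0.eq_or_lt with h0 | hpos
  · rw [← h0, zero_mul]; positivity
  · nlinarith [le_of_mul_le_mul_left hprod hpos]

end LassoBounds

/-- With the universal tuning parameter, the noise correlations are all at most half of it with
probability at least `1 - δ`. -/
lemma gaussianVec_noise_le (n p : ℕ) (hn : 0 < n) (hp : 0 < p) (σ : ℝ) (hσ : 0 < σ)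
    (X : Matrix (Fin n) (Fin p) ℝ) (hX : ∀ j, ∑ i, (X i j) ^ 2 = (n : ℝ))
    (δ : ℝ) (hδ : δ ∈ Set.Ioo (0 : ℝ) 1)
    (lam : ℝ) (hlam : lam = 2 * σ * Real.sqrt (2 * Real.log ((p : ℝ) / δ) / (n : ℝ))) :
    ENNReal.ofReal (1 - δ) ≤
      gaussianVec n σ {ε | ∀ j, |∑ i, X i j * ε i| ≤ n * lam / 2} := by
  obtain ⟨hδ0, hδ1⟩ := hδ
  have hn' : (0 : ℝ) < n := by exact_mod_cast hn
  have hp' : (0 : ℝ) < p := by exact_mod_cast hp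
  have hp1 : (1 : ℝ) ≤ p := by exact_mod_cast hp
  have hlog : 0 ≤ Real.log ((p : ℝ) / δ) := Real.log_nonneg (by rw [le_div_iff₀ hδ0]; linarith)
  have hlam0 : 0 ≤ lam := by rw [hlam]; positivity
  have hprob : IsProbabilityMeasure (gaussianVec n σ) := by unfold gaussianVec; infer_instance
  set v : NNReal := (n : ℝ).toNNReal * (σ ^ 2).toNNReal with hv
  have hvR : (v : ℝ) = n * σ ^ 2 := by simp [hv, Real.coe_toNNReal _ (sq_nonneg σ)]
  have hv0 : v ≠ 0 := by
    rw [← NNReal.coe_ne_zero, hvR]; positivity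
  have hmeas : ∀ j, Measurable fun ε : Fin n → ℝ => ∑ i, X i j * ε i := fun j => by fun_prop
  have htail (j : Fin p) : gaussianVec n σ {ε | n * lam / 2 < |∑ i, X i j * ε i|} ≤
      ENNReal.ofReal (δ / p) := by
    have hset : MeasurableSet {x : ℝ | n * lam / 2 < |x|} :=
      measurableSet_lt measurable_const measurable_id.abs
    have hlaw := map_pi_gaussianReal_sum_mul (σ ^ 2).toNNReal fun i => X i j
    rw [hX j, ← hv] at hlaw
    have h := gaussianReal_abs_gt_le v hv0 (n * lam / 2) (by positivity)
    rw [← hlaw, Measure.map_apply (hmeas j) hset] at h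
    refine h.trans (ENNReal.ofReal_le_ofReal (le_of_eq ?_))
    have hexp : -(n * lam / 2) ^ 2 / (2 * (v : ℝ)) = -Real.log (p / δ) := by
      rw [hvR, hlam, div_eq_iff (by positivity)]
      have hsq := Real.sq_sqrt (x := 2 * Real.log ((p : ℝ) / δ) / (n : ℝ)) (by positivity)
      calc -(n * (2 * σ * √(2 * Real.log (p / δ) / n)) / 2) ^ 2
          = -(n ^ 2 * σ ^ 2 * √(2 * Real.log (p / δ) / n) ^ 2) := by ring
        _ = _ := by rw [hsq]; field_simp
    rw [hexp, Real.exp_neg, Real.exp_log (by positivity), inv_div]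
  have hcompl : gaussianVec n σ {ε | ∀ j, |∑ i, X i j * ε i| ≤ n * lam / 2}ᶜ ≤
      ENNReal.ofReal δ := by
    have hU : {ε : Fin n → ℝ | ∀ j, |∑ i, X i j * ε i| ≤ n * lam / 2}ᶜ =
        ⋃ j, {ε | n * lam / 2 < |∑ i, X i j * ε i|} := by
      ext ε; simp
    rw [hU]
    calc _ ≤ ∑ j : Fin p, gaussianVec n σ {ε | n * lam / 2 < |∑ i, X i j * ε i|} :=
          measure_iUnion_fintype_le _ _
      _ ≤ ∑ _j : Fin p, ENNReal.ofReal (δ / p) := Finset.sum_le_sum fun j _ => htail j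
      _ = ENNReal.ofReal δ := by
          rw [← ENNReal.ofReal_sum_of_nonneg fun _ _ => by positivity]
          congr 1
          simp only [Finset.sum_const, Finset.card_univ, Fintype.card_fin, nsmul_eq_mul]
          field_simp
  have hmset : MeasurableSet {ε : Fin n → ℝ | ∀ j, |∑ i, X i j * ε i| ≤ n * lam / 2} := by
    rw [Set.ofPred_forall]
    exact MeasurableSet.iInter fun j => measurableSet_le (hmeas j).abs measurable_const
  rw [ENNReal.ofReal_sub _ hδ0.le, ENNReal.ofReal_one, tsub_le_iff_right,
    ← prob_add_prob_compl (μ := gaussianVec n σ) hmset]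
  gcongr

theorem stmt1 (n p s : ℕ) (hn : 0 < n) (hp : 0 < p) (σ : ℝ) (hσ : 0 < σ)
    (X : Matrix (Fin n) (Fin p) ℝ)
    (hX : ∀ j, ∑ i, (X i j) ^ 2 = (n : ℝ))
    (bstar : Fin p → ℝ)
    (hs : (Finset.univ.filter fun j => bstar j ≠ 0).card = s)
    (κ3 : ℝ) (hRE : RE X 3 s κ3)
    (δ : ℝ) (hδ : δ ∈ Set.Ioo (0 : ℝ) 1)
    (lam : ℝ) (hlam : lam = 2 * σ * Real.sqrt (2 * Real.log ((p : ℝ) / δ) / (n : ℝ))) :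
    ENNReal.ofReal (1 - δ) ≤
      gaussianVec n σ
        {ε | ∀ bhat : Fin p → ℝ, IsLassoSol X (X.mulVec bstar + ε) lam bhat →
          l2sq (X.mulVec (bstar - bhat)) / (n : ℝ) ≤
            9 * lam ^ 2 * (s : ℝ) / (4 * κ3 ^ 2)} := by
  refine (gaussianVec_noise_le n p hn hp σ hσ X hX δ hδ lam hlam).trans (measure_mono ?_)
  intro ε hε bhat hb
  have hp1 : (1 : ℝ) ≤ p := by exact_mod_cast hp
  have hlog : 0 < Real.log ((p : ℝ) / δ) :=
    Real.log_pos (by rw [lt_div_iff₀ hδ.1]; linarith [hδ.2])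
  have hlam0 : 0 < lam := by
    have : (0 : ℝ) < n := by exact_mod_cast hn
    rw [hlam]; positivity
  exact hb.prediction_bound hn hlam0 hs hRE hε
end

section
/- Consider the model y = Xβ* + ε with ε ~ N(0, σ²I_n) and columns of X normalized so that ‖X_j‖₂² = n. Let λ = 2σ√(2 log(p/δ)/n) for δ ∈ (0,1), let β̂ be a Lasso solution with tuning parameter λ, and let β̄ be any refitting of β̂, i.e. any vector with ‖y − Xβ̄‖₂ ≤ ‖y − Xβ̂‖₂. Then with probability at least 1 − δ, (1/n)‖X(β* − β̄)‖₂² ≤ (1/n)‖X(β* − β̂)‖₂² + λ‖β̄ − β̂‖₁. -/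
open MeasureTheory ProbabilityTheory Finset

/-- One-sided Gaussian tail, compared with the mass of the positive half-line. -/
theorem gaussianReal_Ioi_le {v : NNReal} (hv : v ≠ 0) {t : ℝ} (ht : 0 ≤ t) :
    gaussianReal 0 v (Set.Ioi t) ≤
      ENNReal.ofReal (Real.exp (-t ^ 2 / (2 * v))) * gaussianReal 0 v (Set.Ioi 0) := by
  have hshift : gaussianReal 0 v (Set.Ioi t) = gaussianReal (-t) v (Set.Ioi 0) := by
    rw [← zero_add (-t), ← gaussianReal_map_add_const (-t),
      Measure.map_apply (measurable_add_const _) measurableSet_Ioi]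
    congr 1
    ext x
    simp
  rw [hshift, gaussianReal_apply _ hv, gaussianReal_apply _ hv,
    ← lintegral_const_mul _ (measurable_gaussianPDF 0 v)]
  refine setLIntegral_mono ((measurable_gaussianPDF 0 v).const_mul _) fun x hx => ?_
  have hv' : (0 : ℝ) < v := by positivity
  rw [gaussianPDF, gaussianPDF, ← ENNReal.ofReal_mul (Real.exp_nonneg _)]
  refine ENNReal.ofReal_le_ofReal ?_
  rw [gaussianPDFReal, gaussianPDFReal, mul_left_comm, ← Real.exp_add]
  gcongr
  rw [← add_div]
  gcongr
  nlinarith [mul_nonneg ht (le_of_lt (Set.mem_Ioi.mp hx))]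

/-- Two-sided Gaussian tail bound with the sharp leading constant `1`. -/
theorem gaussianReal_lt_abs_le {v : NNReal} (hv : v ≠ 0) {t : ℝ} (ht : 0 ≤ t) :
    gaussianReal 0 v {x | t < |x|} ≤ ENNReal.ofReal (Real.exp (-t ^ 2 / (2 * v))) := by
  have hsymm : ∀ s : ℝ, gaussianReal 0 v (Set.Iio (-s)) = gaussianReal 0 v (Set.Ioi s) := by
    intro s
    conv_lhs => rw [← neg_zero, ← gaussianReal_map_neg]
    rw [Measure.map_apply measurable_neg measurableSet_Iio]
    congr 1
    ext x
    simp
  have hset : {x : ℝ | t < |x|} = Set.Iio (-t) ∪ Set.Ioi t := by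
    ext x
    simp [lt_abs, or_comm, lt_neg]
  have hhalf : gaussianReal 0 v (Set.Iio 0) + gaussianReal 0 v (Set.Ioi 0) ≤ 1 := by
    rw [← measure_union (Set.Iio_disjoint_Ioi_same) measurableSet_Ioi]
    exact prob_le_one
  have hzero := hsymm 0
  rw [neg_zero] at hzero
  rw [hset]
  refine (measure_union_le _ _).trans ?_
  rw [hsymm t]
  refine (add_le_add (gaussianReal_Ioi_le hv ht) (gaussianReal_Ioi_le hv ht)).trans ?_
  rw [← mul_add]
  rw [hzero] at hhalf
  exact mul_le_of_le_one_right' hhalf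

/-- A linear form of a centered isotropic Gaussian vector is a centered Gaussian. -/
theorem gaussianVec_map_sum_mul (n : ℕ) (σ : ℝ) (a : Fin n → ℝ) :
    (gaussianVec n σ).map (fun ε => ∑ i, a i * ε i) =
      gaussianReal 0 ((∑ i, a i ^ 2) * σ ^ 2).toNNReal := by
  have hmem : ∀ i, MemLp (fun x => a i * x) 2 (gaussianReal 0 (σ ^ 2).toNNReal) := fun i =>
    (memLp_id_gaussianReal' 2 (by simp)).const_mul (a i)
  have hlaw : HasGaussianLaw (fun ε : Fin n → ℝ => ∑ i, a i * ε i) (gaussianVec n σ) := by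
    refine iIndepFun.hasGaussianLaw_fun_sum (X := fun i (ε : Fin n → ℝ) => a i * ε i) (fun i => ?_)
      (iIndepFun_pi (X := fun i x => a i * x) fun i => by fun_prop)
    have heval : HasGaussianLaw (fun ε : Fin n → ℝ => ε i) (gaussianVec n σ) := by
      constructor
      rw [gaussianVec, (measurePreserving_eval _ i).map_eq]
      infer_instance
    exact heval.fun_smul (a i)
  have hmean : ∫ ε, ∑ i, a i * ε i ∂(gaussianVec n σ) = 0 := by
    rw [integral_finsetSum]
    · refine Finset.sum_eq_zero fun i _ => ?_
      rw [gaussianVec, integral_comp_eval (X := fun _ : Fin n => ℝ) (i := i)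
          (μ := fun _ => gaussianReal 0 (σ ^ 2).toNNReal) (f := fun x : ℝ => a i * x) (by fun_prop),
        integral_const_mul, integral_id_gaussianReal, mul_zero]
    · intro i _
      exact ((hmem i).comp_measurePreserving
        (measurePreserving_eval (fun _ => gaussianReal 0 (σ ^ 2).toNNReal) i)).integrable
          (by norm_num)
  have hvar : Var[fun ε => ∑ i, a i * ε i; gaussianVec n σ] = (∑ i, a i ^ 2) * σ ^ 2 := by
    have h := variance_sum_pi hmem
    rw [Finset.sum_fn] at h
    rw [gaussianVec, h, Finset.sum_mul]
    refine Finset.sum_congr rfl fun i _ => ?_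
    rw [variance_const_mul, variance_fun_id_gaussianReal, Real.coe_toNNReal _ (sq_nonneg σ)]
  rw [hlaw.map_eq_gaussianReal, hmean, hvar]

/-- If the noise satisfies `‖Xᵀε‖_∞ ≤ λn/2`, then any vector with no larger residual than `bhat`
has prediction error exceeding that of `bhat` by at most `λ‖bbar − bhat‖₁`. -/
theorem predictionError_le_of_residual_le {n p : ℕ} (hn : 0 < n) (X : Matrix (Fin n) (Fin p) ℝ)
    (bstar bhat bbar : Fin p → ℝ) (ε : Fin n → ℝ) (lam : ℝ)
    (hε : ∀ j, |∑ i, X i j * ε i| ≤ lam * n / 2)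
    (hres : l2 (X.mulVec bstar + ε - X.mulVec bbar) ≤ l2 (X.mulVec bstar + ε - X.mulVec bhat)) :
    l2sq (X.mulVec (bstar - bbar)) / (n : ℝ) ≤
      l2sq (X.mulVec (bstar - bhat)) / (n : ℝ) + lam * l1 (bbar - bhat) := by
  have hn' : (0 : ℝ) < n := by exact_mod_cast hn
  have hsq : l2sq (X.mulVec bstar + ε - X.mulVec bbar) ≤
      l2sq (X.mulVec bstar + ε - X.mulVec bhat) :=
    (Real.sqrt_le_sqrt_iff (Finset.sum_nonneg fun i _ => sq_nonneg _)).mp hres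
  have hexpand : ∀ b : Fin p → ℝ, l2sq (X.mulVec bstar + ε - X.mulVec b) =
      l2sq (X.mulVec (bstar - b)) + 2 * ∑ i, ε i * X.mulVec (bstar - b) i + l2sq ε := by
    intro b
    simp only [l2sq, Matrix.mulVec_sub, Finset.mul_sum, ← Finset.sum_add_distrib]
    refine Finset.sum_congr rfl fun i _ => ?_
    simp only [Pi.add_apply, Pi.sub_apply]
    ring
  have hcross : ∑ i, ε i * X.mulVec (bstar - bhat) i - ∑ i, ε i * X.mulVec (bstar - bbar) i =
      ∑ j, (∑ i, X i j * ε i) * (bbar - bhat) j := by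
    simp_rw [← Finset.sum_sub_distrib, Finset.sum_mul]
    rw [Finset.sum_comm]
    refine Finset.sum_congr rfl fun i _ => ?_
    simp only [Matrix.mulVec, dotProduct, ← mul_sub, ← Finset.sum_sub_distrib, Finset.mul_sum]
    refine Finset.sum_congr rfl fun j _ => ?_
    simp only [Pi.sub_apply]
    ring
  have hholder : ∑ j, (∑ i, X i j * ε i) * (bbar - bhat) j ≤
      lam * n / 2 * l1 (bbar - bhat) := by
    rw [l1, Finset.mul_sum]
    refine Finset.sum_le_sum fun j _ => (le_abs_self _).trans ?_
    rw [abs_mul]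
    exact mul_le_mul_of_nonneg_right (hε j) (abs_nonneg _)
  rw [hexpand, hexpand] at hsq
  rw [div_le_iff₀ hn', add_mul, div_mul_cancel₀ _ hn'.ne']
  linarith

theorem stmt2 (n p : ℕ) (hn : 0 < n) (hp : 0 < p) (σ : ℝ) (hσ : 0 < σ)
    (X : Matrix (Fin n) (Fin p) ℝ)
    (hX : ∀ j, ∑ i, (X i j) ^ 2 = (n : ℝ))
    (bstar : Fin p → ℝ)
    (δ : ℝ) (hδ : δ ∈ Set.Ioo (0 : ℝ) 1)
    (lam : ℝ) (hlam : lam = 2 * σ * Real.sqrt (2 * Real.log ((p : ℝ) / δ) / (n : ℝ))) :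
    ENNReal.ofReal (1 - δ) ≤
      gaussianVec n σ
        {ε | ∀ bhat bbar : Fin p → ℝ,
          IsLassoSol X (X.mulVec bstar + ε) lam bhat →
          l2 (X.mulVec bstar + ε - X.mulVec bbar) ≤ l2 (X.mulVec bstar + ε - X.mulVec bhat) →
          l2sq (X.mulVec (bstar - bbar)) / (n : ℝ) ≤
            l2sq (X.mulVec (bstar - bhat)) / (n : ℝ) + lam * l1 (bbar - bhat)} := by
  obtain ⟨hδ0, hδ1⟩ := hδ
  have hn' : (0 : ℝ) < n := by exact_mod_cast hn
  have hp' : (1 : ℝ) ≤ p := by exact_mod_cast hp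
  have hlog : 0 ≤ Real.log (p / δ) := Real.log_nonneg ((one_le_div hδ0).mpr (by linarith))
  have hlam0 : 0 ≤ lam := by rw [hlam]; positivity
  have hlamsq : lam ^ 2 = 8 * σ ^ 2 * Real.log (p / δ) / n := by
    rw [hlam, mul_pow, Real.sq_sqrt (by positivity)]
    ring
  have : IsProbabilityMeasure (gaussianVec n σ) := by unfold gaussianVec; infer_instance
  set bad : Fin p → Set (Fin n → ℝ) := fun j => {ε | lam * n / 2 < |∑ i, X i j * ε i|}
  have hmeas : ∀ j, MeasurableSet (bad j) := fun j =>
    measurableSet_lt measurable_const (by fun_prop)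
  have htail : ∀ j, gaussianVec n σ (bad j) ≤ ENNReal.ofReal (δ / p) := by
    intro j
    have hv : ((∑ i, X i j ^ 2) * σ ^ 2).toNNReal ≠ 0 := by
      rw [hX j]
      exact (Real.toNNReal_pos.mpr (by positivity)).ne'
    have h := gaussianReal_lt_abs_le hv (t := lam * n / 2) (by positivity)
    rw [← gaussianVec_map_sum_mul, Measure.map_apply (by fun_prop)
      (measurableSet_lt measurable_const (by fun_prop))] at h
    refine h.trans (ENNReal.ofReal_le_ofReal (le_of_eq ?_))
    have hexponent : -(lam * n / 2) ^ 2 / (2 * (n * σ ^ 2)) = -Real.log (p / δ) := by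
      rw [div_pow, mul_pow, hlamsq]
      field_simp
      ring
    rw [hX j, Real.coe_toNNReal _ (by positivity), hexponent, Real.exp_neg,
      Real.exp_log (by positivity), inv_div]
  have hunion : gaussianVec n σ (⋃ j, bad j) ≤ ENNReal.ofReal δ := by
    refine (measure_iUnion_fintype_le _ _).trans ((Finset.sum_le_sum fun j _ => htail j).trans ?_)
    rw [Finset.sum_const, Finset.card_univ, Fintype.card_fin, nsmul_eq_mul,
      ← ENNReal.ofReal_natCast, ← ENNReal.ofReal_mul (by positivity),
      mul_div_cancel₀ _ (by positivity)]
  calc ENNReal.ofReal (1 - δ)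
      = 1 - ENNReal.ofReal δ := by rw [ENNReal.ofReal_sub _ hδ0.le, ENNReal.ofReal_one]
    _ ≤ 1 - gaussianVec n σ (⋃ j, bad j) := tsub_le_tsub_left hunion 1
    _ = gaussianVec n σ (⋃ j, bad j)ᶜ := (prob_compl_eq_one_sub (.iUnion hmeas)).symm
    _ ≤ _ := by
      refine measure_mono fun ε hε bhat bbar _ hres => ?_
      refine predictionError_le_of_residual_le hn X bstar bhat bbar ε lam (fun j => ?_) hres
      by_contra hj
      exact hε (Set.mem_iUnion.mpr ⟨j, not_le.mp hj⟩)
end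

section
/- Consider the model y = Xβ* + ε. For any Lasso solution β̂^{λ₁} with tuning parameter λ₁ > 0 and any λ₂ > 0, on the event {‖Xᵀε/n‖_∞ ≤ λ₁/2} the Boosted Lasso β̂^{λ₁,λ₂} satisfies (1/n)‖X(β* − β̂^{λ₁,λ₂})‖₂² + (2λ₂ − λ₁)‖β̂^{λ₁,λ₂} − β̂^{λ₁}‖₁ ≤ (1/n)‖X(β* − β̂^{λ₁})‖₂². -/
open MeasureTheory ProbabilityTheory Finset

lemma l2sq_add {m : ℕ} (u v : Fin m → ℝ) :
    l2sq (u + v) = l2sq u + 2 * (v ⬝ᵥ u) + l2sq v := by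
  simp only [l2sq, dotProduct, Pi.add_apply, Finset.mul_sum, ← Finset.sum_add_distrib]
  exact Finset.sum_congr rfl fun i _ => by ring

/-- Hölder's inequality between the sup norm and the ℓ₁ norm. -/
lemma dotProduct_le_mul_l1 {m : ℕ} {u : Fin m → ℝ} {c : ℝ} (hu : ∀ j, |u j| ≤ c)
    (v : Fin m → ℝ) : u ⬝ᵥ v ≤ c * l1 v := by
  simp only [l1, dotProduct, Finset.mul_sum]
  refine Finset.sum_le_sum fun j _ => (le_abs_self _).trans ?_
  rw [abs_mul]
  exact mul_le_mul_of_nonneg_right (hu j) (abs_nonneg _)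

lemma dotProduct_mulVec_div_le {n p : ℕ} (X : Matrix (Fin n) (Fin p) ℝ) {ε : Fin n → ℝ} {c : ℝ}
    (h : ∀ j, |X.transpose.mulVec ε j / (n : ℝ)| ≤ c) (v : Fin p → ℝ) :
    (ε ⬝ᵥ X.mulVec v) / (n : ℝ) ≤ c * l1 v := by
  refine le_of_eq_of_le ?_ (dotProduct_le_mul_l1 h v)
  rw [Matrix.dotProduct_mulVec, ← Matrix.mulVec_transpose]
  simp only [dotProduct, Finset.sum_div]
  exact Finset.sum_congr rfl fun j _ => by ring

theorem stmt6 (n p : ℕ) (hn : 0 < n) (hp : 0 < p)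
    (X : Matrix (Fin n) (Fin p) ℝ)
    (bstar : Fin p → ℝ) (ε : Fin n → ℝ)
    (lam1 lam2 : ℝ) (hlam1 : 0 < lam1) (hlam2 : 0 < lam2)
    (bhat : Fin p → ℝ) (hb : IsLassoSol X (X.mulVec bstar + ε) lam1 bhat)
    (bb : Fin p → ℝ) (hbb : IsBoostedSol X (X.mulVec bstar + ε) lam2 bhat bb)
    (hev : ∀ j, |X.transpose.mulVec ε j / (n : ℝ)| ≤ lam1 / 2) :
    l2sq (X.mulVec (bstar - bb)) / (n : ℝ) + (2 * lam2 - lam1) * l1 (bb - bhat) ≤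
      l2sq (X.mulVec (bstar - bhat)) / (n : ℝ) := by
  have hdual := dotProduct_mulVec_div_le X hev (bb - bhat)
  have hmin := hbb bhat
  have hres : ∀ b, X.mulVec bstar + ε - X.mulVec b = X.mulVec (bstar - b) + ε := fun b => by
    rw [Matrix.mulVec_sub]; abel
  have hcross : ε ⬝ᵥ X.mulVec (bb - bhat) =
      ε ⬝ᵥ X.mulVec (bstar - bhat) - ε ⬝ᵥ X.mulVec (bstar - bb) := by
    simp only [Matrix.mulVec_sub, dotProduct_sub]; ring
  have hzero : l1 (bhat - bhat) = 0 := by simp [l1]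
  rw [hcross] at hdual
  simp only [boostedObj, hres, l2sq_add, hzero] at hmin
  have hsplit : ∀ a d e : ℝ, (a + 2 * d + e) / (2 * (n : ℝ)) =
      a / n / 2 + d / n + e / n / 2 := fun a d e => by
    field_simp
  rw [hsplit, hsplit] at hmin
  rw [sub_div] at hdual
  linarith
end

section
/- Let β̂^{λ₁} be a Lasso solution with parameter λ₁ > 0 and let ρ̂^{λ₁} = (1/(λ₁n))Xᵀ(y − Xβ̂^{λ₁}) be the associated subgradient. Set ȳ = y + (λ₂/λ₁)(y − Xβ̂^{λ₁}). Then the Bregman Lasso with parameters (λ₁, λ₂) can be computed as a Lasso problem with modified response: argmin_{β ∈ ℝᵖ} (1/2n)‖y − Xβ‖₂² + λ₂(‖β‖₁ − ⟨ρ̂^{λ₁}, β⟩) = argmin_{β ∈ ℝᵖ} (1/2n)‖ȳ − Xβ‖₂² + λ₂‖β‖₁. -/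
open MeasureTheory ProbabilityTheory Finset

/-- Pairing the Lasso subgradient with `β` gives `⟨y − Xβ̂, Xβ⟩ / (λn)`. -/
theorem sum_lassoSubgrad_mul {n p : ℕ} (X : Matrix (Fin n) (Fin p) ℝ) (y : Fin n → ℝ) (lam : ℝ)
    (b β : Fin p → ℝ) :
    ∑ j, lassoSubgrad X y lam b j * β j =
      ((y - X.mulVec b) ⬝ᵥ X.mulVec β) / (lam * (n : ℝ)) := by
  rw [Matrix.dotProduct_mulVec, ← Matrix.mulVec_transpose, dotProduct, Finset.sum_div]
  refine Finset.sum_congr rfl fun j _ => ?_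
  rw [lassoSubgrad, div_mul_eq_mul_div]

/-- Expansion of `‖y + c r − v‖²` around `‖y − v‖²`. -/
theorem l2sq_add_smul_sub {m : ℕ} (y r v : Fin m → ℝ) (c : ℝ) :
    l2sq (y + c • r - v) =
      l2sq (y - v) - 2 * c * (r ⬝ᵥ v) + (2 * c * (r ⬝ᵥ y) + c ^ 2 * l2sq r) := by
  simp only [l2sq, dotProduct, Finset.mul_sum, ← Finset.sum_add_distrib,
    ← Finset.sum_sub_distrib, Pi.add_apply, Pi.sub_apply, Pi.smul_apply, smul_eq_mul]
  exact Finset.sum_congr rfl fun i _ => by ring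

/-- The Lasso objective at the modified response is the Bregman objective plus a constant. -/
theorem lassoObj_add_smul_residual {n p : ℕ} (hn : 0 < n) (X : Matrix (Fin n) (Fin p) ℝ)
    (y : Fin n → ℝ) {lam1 : ℝ} (hlam1 : lam1 ≠ 0) (lam2 : ℝ) (bhat β : Fin p → ℝ) :
    lassoObj X (y + (lam2 / lam1) • (y - X.mulVec bhat)) lam2 β =
      bregmanObj X y lam1 lam2 bhat β +
        (2 * (lam2 / lam1) * ((y - X.mulVec bhat) ⬝ᵥ y) +
          (lam2 / lam1) ^ 2 * l2sq (y - X.mulVec bhat)) / (2 * (n : ℝ)) := by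
  have hn' : (n : ℝ) ≠ 0 := Nat.cast_ne_zero.mpr hn.ne'
  rw [lassoObj, bregmanObj, sum_lassoSubgrad_mul, l2sq_add_smul_sub]
  field_simp
  ring

theorem stmt9 (n p : ℕ) (hn : 0 < n) (hp : 0 < p)
    (X : Matrix (Fin n) (Fin p) ℝ) (y : Fin n → ℝ)
    (lam1 lam2 : ℝ) (hlam1 : 0 < lam1) (hlam2 : 0 < lam2)
    (bhat : Fin p → ℝ) (hb : IsLassoSol X y lam1 bhat)
    (ybar : Fin n → ℝ)
    (hybar : ybar = fun i => y i + lam2 / lam1 * (y i - X.mulVec bhat i)) :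
    ∀ b : Fin p → ℝ,
      IsBregmanSol X y lam1 lam2 bhat b ↔
      (∀ β : Fin p → ℝ,
        l2sq (ybar - X.mulVec b) / (2 * (n : ℝ)) + lam2 * l1 b ≤
          l2sq (ybar - X.mulVec β) / (2 * (n : ℝ)) + lam2 * l1 β) := by
  intro b
  have hy : ybar = y + (lam2 / lam1) • (y - X.mulVec bhat) := hybar
  change _ ↔ ∀ β, lassoObj X ybar lam2 b ≤ lassoObj X ybar lam2 β
  simp only [hy, lassoObj_add_smul_residual hn X y hlam1.ne', add_le_add_iff_right, IsBregmanSol]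
end
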